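/- arXiv:1511.06518 — 2 statements merged into one kernel-verified Lean document; each statement's English description precedes it below -/
import Mathlib

section
/- Let N_A, N_B ≥ 1 be natural numbers, γ̄_B > 0 and σ ∈ (0,1) real, α = Γ(N_B + 1)^{1/N_B}, and let R_b > 0 with μ = 2^{R_b} - 1. If 1 - P(N_B, μ/γ̄_B)^{N_A} ≥ σ, then R_b ≤ log₂(1 + γ̄_B · α · log(1 / (1 - (1-σ)^{1/(N_A · N_B)}))). -/
open Real MeasureTheory ProbabilityTheory Filter

/-- The regularized lower incomplete gamma function
`P(s,x) = (∫₀ˣ t^(s-1) e^(-t) dt) / Γ(s)`. -/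
noncomputable def regP (s x : ℝ) : ℝ :=
  (∫ t in (0:ℝ)..x, t ^ (s - 1) * Real.exp (-t)) / Real.Gamma s

open scoped Nat in
lemma regP_natCast_succ (m : ℕ) (x : ℝ) :
    regP ((m + 1 : ℕ) : ℝ) x = (∫ t in (0:ℝ)..x, t ^ m * Real.exp (-t)) / (m ! : ℝ) := by
  simp [regP, Real.Gamma_nat_eq_factorial]

/-- The mean of `exp (u * t)` over `t ∈ [0, 1]`. -/
lemma integral_exp_mul_unitInterval {u : ℝ} (hu : u ≠ 0) :
    ∫ t in (0:ℝ)..1, Real.exp (u * t) = (Real.exp u - 1) / u := by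
  rw [intervalIntegral.integral_comp_mul_left (fun t => Real.exp t) hu]
  simp [div_eq_inv_mul]

lemma exp_sub_one_div_pos {u : ℝ} (hu : 0 < u) : 0 < (Real.exp u - 1) / u :=
  div_pos (by linarith [Real.add_one_lt_exp hu.ne']) hu

/-- Jensen's inequality for the means of `exp (u * t)` over `t ∈ [0, 1]`. -/
lemma exp_sub_one_div_rpow_le {u v : ℝ} (hu : 0 < u) (huv : u ≤ v) :
    ((Real.exp u - 1) / u) ^ (v / u) ≤ (Real.exp v - 1) / v := by
  have hv : 0 < v := hu.trans_le huv
  set M := (Real.exp u - 1) / u with hM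
  have hMpos : 0 < M := exp_sub_one_div_pos hu
  have hr : 1 ≤ v / u := (one_le_div hu).2 huv
  have key : ∀ t : ℝ, 1 + v / u * (Real.exp (u * t) / M - 1) ≤ Real.exp (v * t) / M ^ (v / u) := by
    intro t
    have h0 : 0 < Real.exp (u * t) / M := div_pos (Real.exp_pos _) hMpos
    have := one_add_mul_self_le_rpow_one_add (s := Real.exp (u * t) / M - 1) (by linarith) hr
    rw [add_sub_cancel, Real.div_rpow (Real.exp_pos _).le hMpos.le, ← Real.exp_mul] at this
    convert this using 3
    field_simp
  have hint : ∫ t in (0:ℝ)..1, (1 + v / u * (Real.exp (u * t) / M - 1)) ≤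
      ∫ t in (0:ℝ)..1, Real.exp (v * t) / M ^ (v / u) :=
    intervalIntegral.integral_mono_on zero_le_one
      (Continuous.intervalIntegrable (by fun_prop) _ _)
      (Continuous.intervalIntegrable (by fun_prop) _ _) fun t _ => key t
  rw [intervalIntegral.integral_add (by simp)
      (Continuous.intervalIntegrable (by fun_prop) _ _), intervalIntegral.integral_const_mul,
    intervalIntegral.integral_sub (Continuous.intervalIntegrable (by fun_prop) _ _) (by simp),
    intervalIntegral.integral_div, intervalIntegral.integral_div,
    integral_exp_mul_unitInterval hu.ne', integral_exp_mul_unitInterval hv.ne', ← hM,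
    div_self hMpos.ne'] at hint
  simp only [intervalIntegral.integral_const, sub_zero, sub_self, mul_zero, add_zero, one_smul]
    at hint
  rwa [one_le_div (Real.rpow_pos_of_pos hMpos _)] at hint

/-- The two densities compared in `one_sub_exp_neg_pow_le_regP` cross at most once. -/
lemma one_sub_exp_pow_mul_exp_le_of_le {m : ℕ} {b x y : ℝ} (hb : 0 < b) (hx : 0 < x) (hxy : x ≤ y)
    (h : (1 - Real.exp (-(b * y))) ^ m * Real.exp (-(b * y)) ≤ (b * y) ^ m * Real.exp (-y)) :
    (1 - Real.exp (-(b * x))) ^ m * Real.exp (-(b * x)) ≤ (b * x) ^ m * Real.exp (-x) := by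
  have hy : 0 < y := hx.trans_le hxy
  have equiv : ∀ z : ℝ, 0 < z →
      ((1 - Real.exp (-(b * z))) ^ m * Real.exp (-(b * z)) ≤ (b * z) ^ m * Real.exp (-z) ↔
        m * Real.log ((Real.exp (b * z) - 1) / (b * z)) ≤ ((m + 1) * b - 1) * z) := by
    intro z hz
    have hbz : 0 < b * z := mul_pos hb hz
    have hMpos := exp_sub_one_div_pos hbz
    have e1 : 1 - Real.exp (-(b * z)) =
        (b * z) * (((Real.exp (b * z) - 1) / (b * z)) * Real.exp (-(b * z))) := by
      have : Real.exp (b * z) * Real.exp (-(b * z)) = 1 := by rw [← Real.exp_add]; simp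
      field_simp
      linear_combination -this
    rw [e1, mul_pow, mul_assoc, mul_le_mul_iff_right₀ (pow_pos hbz m),
      ← Real.log_le_log_iff (by positivity) (Real.exp_pos _), Real.log_mul (by positivity)
      (by positivity), Real.log_pow, Real.log_mul hMpos.ne' (by positivity), Real.log_exp,
      Real.log_exp]
    constructor <;> intro h <;> nlinarith
  rw [equiv y hy] at h
  rw [equiv x hx]
  have hMx := exp_sub_one_div_pos (mul_pos hb hx)
  have hM := Real.log_le_log (Real.rpow_pos_of_pos hMx _)
    (exp_sub_one_div_rpow_le (mul_pos hb hx) (mul_le_mul_of_nonneg_left hxy hb.le))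
  rw [Real.log_rpow hMx, mul_div_mul_left _ _ hb.ne'] at hM
  have h2 : y / x * (m * Real.log ((Real.exp (b * x) - 1) / (b * x))) ≤
      y / x * (((m + 1) * b - 1) * x) := by
    calc _ = m * (y / x * Real.log ((Real.exp (b * x) - 1) / (b * x))) := by ring
      _ ≤ m * Real.log ((Real.exp (b * y) - 1) / (b * y)) := by gcongr
      _ ≤ ((m + 1) * b - 1) * y := h
      _ = _ := by field_simp
  exact le_of_mul_le_mul_left h2 (div_pos hy hx)

open scoped Nat Topology in
lemma tendsto_integral_pow_mul_exp_neg (m : ℕ) :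
    Tendsto (fun x : ℝ => ∫ t in (0:ℝ)..x, t ^ m * Real.exp (-t)) atTop (𝓝 (m ! : ℝ)) := by
  have hc := Real.GammaIntegral_convergent (s := (m : ℝ) + 1) (by positivity)
  have he := Real.Gamma_eq_integral (s := (m : ℝ) + 1) (by positivity)
  rw [Real.Gamma_nat_eq_factorial] at he
  simp only [add_sub_cancel_right, Real.rpow_natCast, mul_comm (Real.exp _)] at hc he
  rw [he]
  exact intervalIntegral_tendsto_integral_Ioi 0 hc tendsto_id

open scoped Nat Topology in
/-- Alzer's lower bound for the regularized incomplete gamma function, at integer order. -/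
lemma one_sub_exp_neg_pow_le_regP (m : ℕ) {b x : ℝ} (hb : 0 < b)
    (hbm : b ^ (m + 1) * ((m + 1) ! : ℝ) = 1) (hx : 0 ≤ x) :
    (1 - Real.exp (-(b * x))) ^ (m + 1) ≤ regP ((m + 1 : ℕ) : ℝ) x := by
  rcases hx.eq_or_lt with rfl | hx
  · simp [regP]
  set G : ℝ → ℝ := fun y => (∫ t in (0:ℝ)..y, t ^ m * Real.exp (-t)) / (m ! : ℝ) -
    (1 - Real.exp (-(b * y))) ^ (m + 1) with hG
  have hm : (0:ℝ) < m ! := by positivity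
  have hfac : 1 / (m ! : ℝ) = (m + 1) * b * b ^ m := by
    rw [Nat.factorial_succ] at hbm
    push_cast at hbm
    field_simp
    linear_combination -hbm
  have hderiv : ∀ y, HasDerivAt G ((m + 1) * b * ((b * y) ^ m * Real.exp (-y) -
      (1 - Real.exp (-(b * y))) ^ m * Real.exp (-(b * y)))) y := by
    intro y
    have h1 : HasDerivAt (fun y : ℝ => ∫ t in (0:ℝ)..y, t ^ m * Real.exp (-t))
        (y ^ m * Real.exp (-y)) y :=
      have hf : Continuous fun t : ℝ => t ^ m * Real.exp (-t) := by fun_prop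
      intervalIntegral.integral_hasDerivAt_right (hf.intervalIntegrable _ _)
        (hf.stronglyMeasurableAtFilter _ _) hf.continuousAt
    have h2 : HasDerivAt (fun y : ℝ => (1 - Real.exp (-(b * y))) ^ (m + 1)) _ y :=
      ((((hasDerivAt_id y).const_mul b).neg.exp).const_sub 1).pow (m + 1)
    refine ((h1.div_const (m ! : ℝ)).sub h2).congr_deriv ?_
    rw [div_eq_mul_one_div, hfac]
    simp only [id, Pi.neg_apply, Nat.add_sub_cancel, Nat.cast_add, Nat.cast_one]
    ring
  have hcont : Continuous G := continuous_iff_continuousAt.2 fun y => (hderiv y).continuousAt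
  suffices 0 ≤ G x by
    rw [regP_natCast_succ]
    exact sub_nonneg.1 this
  have hmb : 0 ≤ ((m:ℝ) + 1) * b := by positivity
  by_cases hA : (1 - Real.exp (-(b * x))) ^ m * Real.exp (-(b * x)) ≤ (b * x) ^ m * Real.exp (-x)
  · have hmono : MonotoneOn G (Set.Icc 0 x) := by
      refine monotoneOn_of_hasDerivWithinAt_nonneg (convex_Icc 0 x) hcont.continuousOn
        (fun y _ => (hderiv y).hasDerivWithinAt) fun y hy => ?_
      rw [interior_Icc] at hy
      exact mul_nonneg hmb (sub_nonneg.2 (one_sub_exp_pow_mul_exp_le_of_le hb hy.1 hy.2.le hA))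
    have := hmono ⟨le_rfl, hx.le⟩ ⟨hx.le, le_rfl⟩ hx.le
    simpa [hG] using this
  · have hanti : AntitoneOn G (Set.Ici x) := by
      refine antitoneOn_of_hasDerivWithinAt_nonpos (convex_Ici x) hcont.continuousOn
        (fun y _ => (hderiv y).hasDerivWithinAt) fun y hy => ?_
      rw [interior_Ici] at hy
      refine mul_nonpos_of_nonneg_of_nonpos hmb (sub_nonpos.2 ?_)
      by_contra! hlt
      exact hA (one_sub_exp_pow_mul_exp_le_of_le hb hx (le_of_lt hy) hlt.le)
    have hexp : Tendsto (fun y : ℝ => Real.exp (-(b * y))) atTop (𝓝 0) :=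
      Real.tendsto_exp_neg_atTop_nhds_zero.comp (tendsto_id.const_mul_atTop hb)
    have hlim : Tendsto G atTop (𝓝 0) := by
      have := ((tendsto_integral_pow_mul_exp_neg m).div_const (m ! : ℝ)).sub
        ((hexp.const_sub 1).pow (m + 1))
      simpa [hG, div_self hm.ne'] using this
    refine le_of_tendsto hlim ?_
    filter_upwards [eventually_ge_atTop x] with y hy
    exact hanti Set.self_mem_Ici hy hy

theorem stmt8 (N_A N_B : ℕ) (hA : 1 ≤ N_A) (hB : 1 ≤ N_B)
    (γB σ Rb α μ : ℝ) (hγ : 0 < γB) (hσ : σ ∈ Set.Ioo (0:ℝ) 1) (hRb : 0 < Rb)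
    (hα : α = Real.Gamma ((N_B:ℝ) + 1) ^ ((1:ℝ)/N_B))
    (hμ : μ = 2 ^ Rb - 1)
    (h : 1 - regP N_B (μ / γB) ^ N_A ≥ σ) :
    Rb ≤ Real.logb 2 (1 + γB * α * Real.log (1 / (1 - (1 - σ) ^ ((1:ℝ)/(N_A * N_B))))) := by
  obtain ⟨m, rfl⟩ : ∃ m, N_B = m + 1 := ⟨N_B - 1, by omega⟩
  obtain ⟨hσ0, hσ1⟩ := hσ
  have hμ0 : 0 < μ := by
    rw [hμ, sub_pos]
    exact Real.one_lt_rpow one_lt_two hRb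
  rw [Real.Gamma_nat_eq_factorial] at hα
  have hα0 : 0 < α := by rw [hα]; positivity
  have hαpow : α ^ (m + 1) = ((m + 1).factorial : ℝ) := by
    rw [hα, one_div, Real.rpow_inv_natCast_pow (by positivity) (by omega)]
  set x := μ / γB with hx
  have hx0 : 0 < x := div_pos hμ0 hγ
  have hbound := one_sub_exp_neg_pow_le_regP m (inv_pos.2 hα0)
    (by rw [← hαpow, ← mul_pow, inv_mul_cancel₀ hα0.ne', one_pow]) hx0.le
  set q := 1 - Real.exp (-(α⁻¹ * x)) with hq
  have hq0 : 0 ≤ q := by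
    rw [hq, sub_nonneg, Real.exp_le_one_iff, neg_nonpos]
    positivity
  have hpow : q ^ (N_A * (m + 1)) ≤ 1 - σ := by
    rw [mul_comm, pow_mul]
    have := pow_le_pow_left₀ (pow_nonneg hq0 _) hbound N_A
    linarith
  set c := (1 - σ) ^ ((1:ℝ) / (N_A * (m + 1 : ℕ))) with hc
  have hN : 0 < N_A * (m + 1) := by positivity
  have hqc : q ≤ c := by
    rw [hc, ← Nat.cast_mul, one_div, ← Real.pow_rpow_inv_natCast hq0 hN.ne']
    gcongr
  have hc1 : c < 1 :=
    Real.rpow_lt_one (by linarith) (by linarith) (by rw [← Nat.cast_mul]; positivity)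
  have hlog : α⁻¹ * x ≤ Real.log (1 / (1 - c)) := by
    rw [one_div, Real.log_inv, le_neg, Real.log_le_iff_le_exp (by linarith)]
    linarith
  have hmul : μ ≤ γB * α * Real.log (1 / (1 - c)) := by
    calc μ = γB * α * (α⁻¹ * x) := by rw [hx]; field_simp
      _ ≤ _ := by gcongr
  rw [Real.le_logb_iff_rpow_le one_lt_two (by linarith)]
  linarith
end

section
/- Let N_A, N_B ≥ 1 be natural numbers, γ̄_B > 0 and R_e ≥ 0 real, and define T_s(R_b) = (R_b - R_e) · (1 - P(N_B, (2^{R_b} - 1)/γ̄_B)^{N_A}) for R_b ≥ R_e. Then T_s(R_e) = 0, T_s(R_b) > 0 for all R_b > R_e, and there exists R_b* > R_e at which T_s attains its supremum over [R_e, ∞); moreover every such maximizer R_b* satisfies the stationarity equation 1 - P(N_B, y*)^{N_A} = β* · (y*)^{N_B - 1} · e^{-y*} · P(N_B, y*)^{N_A - 1}, where y* = (2^{R_b*} - 1)/γ̄_B and β* = (log 2 · N_A · (R_b* - R_e) · 2^{R_b*}) / (Γ(N_B) · γ̄_B). -/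
open Real MeasureTheory ProbabilityTheory Filter

theorem continuous_rpow_mul_exp_neg {s : ℝ} (hs : 1 ≤ s) :
    Continuous fun t : ℝ => t ^ (s - 1) * Real.exp (-t) :=
  (continuous_id.rpow_const fun _ => Or.inr (by linarith)).mul (by fun_prop)

theorem hasDerivAt_regP {s : ℝ} (hs : 1 ≤ s) (x : ℝ) :
    HasDerivAt (regP s) (x ^ (s - 1) * Real.exp (-x) / Real.Gamma s) x := by
  have hc := continuous_rpow_mul_exp_neg hs
  exact (intervalIntegral.integral_hasDerivAt_right (hc.intervalIntegrable _ _)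
    hc.stronglyMeasurable.stronglyMeasurableAtFilter hc.continuousAt).div_const _

theorem integrableOn_rpow_mul_exp_neg {s : ℝ} (hs : 0 < s) {x : ℝ} (hx : 0 ≤ x) :
    IntegrableOn (fun t : ℝ => t ^ (s - 1) * Real.exp (-t)) (Set.Ioi x) := by
  have h := Real.GammaIntegral_convergent hs
  simp only [mul_comm (Real.exp _)] at h
  exact h.mono_set (Set.Ioi_subset_Ioi hx)

theorem one_sub_regP {s : ℝ} (hs : 0 < s) {x : ℝ} (hx : 0 ≤ x) :
    1 - regP s x = (∫ t in Set.Ioi x, t ^ (s - 1) * Real.exp (-t)) / Real.Gamma s := by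
  have hG : Real.Gamma s = ∫ t in Set.Ioi (0 : ℝ), t ^ (s - 1) * Real.exp (-t) := by
    rw [Real.Gamma_eq_integral hs]
    simp only [mul_comm (Real.exp _)]
  have h := intervalIntegral.integral_Ioi_sub_Ioi (integrableOn_rpow_mul_exp_neg hs le_rfl) hx
  have hpos := (Real.Gamma_pos_of_pos hs).ne'
  rw [← hG] at h
  rw [regP, ← h]
  field_simp
  ring

theorem regP_nonneg {s : ℝ} (hs : 0 < s) {x : ℝ} (hx : 0 ≤ x) : 0 ≤ regP s x :=
  div_nonneg (intervalIntegral.integral_nonneg hx fun _ ht =>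
    mul_nonneg (Real.rpow_nonneg ht.1 _) (Real.exp_pos _).le) (Real.Gamma_pos_of_pos hs).le

theorem regP_lt_one {s : ℝ} (hs : 0 < s) {x : ℝ} (hx : 0 ≤ x) : regP s x < 1 := by
  rw [← sub_pos, one_sub_regP hs hx]
  refine div_pos ?_ (Real.Gamma_pos_of_pos hs)
  have hpos : ∀ t ∈ Set.Ioi x, 0 < t ^ (s - 1) * Real.exp (-t) := fun _ ht =>
    mul_pos (Real.rpow_pos_of_pos (hx.trans_lt ht) _) (Real.exp_pos _)
  have hsupp : Set.Ioi x ⊆ Function.support fun t : ℝ => t ^ (s - 1) * Real.exp (-t) :=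
    fun t ht => (hpos t ht).ne'
  rw [setIntegral_pos_iff_support_of_nonneg_ae
    ((ae_restrict_mem measurableSet_Ioi).mono fun t ht => (hpos t ht).le)
    (integrableOn_rpow_mul_exp_neg hs hx),
    Set.inter_eq_right.mpr hsupp, Real.volume_Ioi]
  exact ENNReal.zero_lt_top

/-- Markov's inequality for the Gamma distribution of shape `s`, whose mean is `s`. -/
theorem mul_one_sub_regP_le {s : ℝ} (hs : 0 < s) {x : ℝ} (hx : 0 ≤ x) :
    x * (1 - regP s x) ≤ s := by
  have hs' : 0 < s + 1 := by linarith
  have hG := Real.Gamma_pos_of_pos hs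
  have key : x * (∫ t in Set.Ioi x, t ^ (s - 1) * Real.exp (-t)) ≤
      ∫ t in Set.Ioi x, t ^ (s + 1 - 1) * Real.exp (-t) := by
    rw [← integral_const_mul]
    refine setIntegral_mono_on ((integrableOn_rpow_mul_exp_neg hs hx).const_mul x)
      (integrableOn_rpow_mul_exp_neg hs' hx) measurableSet_Ioi fun t ht => ?_
    have ht0 : 0 < t := hx.trans_lt ht
    rw [← mul_assoc, show s + 1 - 1 = 1 + (s - 1) by ring, Real.rpow_add ht0, Real.rpow_one]
    gcongr
    exact ht.le
  have htail := one_sub_regP hs' hx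
  have hP := regP_nonneg hs' hx
  rw [Real.Gamma_add_one hs.ne', eq_div_iff (by positivity)] at htail
  rw [one_sub_regP hs hx, ← mul_div_assoc, div_le_iff₀ hG]
  nlinarith [mul_nonneg hP (mul_pos hs hG).le]

theorem one_sub_pow_le {p : ℝ} (hp : 0 ≤ p) (n : ℕ) : 1 - p ^ n ≤ n * (1 - p) := by
  have := one_add_mul_le_pow (a := p - 1) (by linarith) n
  rw [add_sub_cancel] at this
  linarith

theorem stmt18 (N_A N_B : ℕ) (hA : 1 ≤ N_A) (hB : 1 ≤ N_B) (γB Re : ℝ)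
    (hγ : 0 < γB) (hRe : 0 ≤ Re)
    (Ts : ℝ → ℝ)
    (hTs : ∀ r, Ts r = (r - Re) * (1 - regP N_B ((2 ^ r - 1) / γB) ^ N_A)) :
    Ts Re = 0 ∧ (∀ r, Re < r → 0 < Ts r) ∧
      (∃ Rbstar, Re < Rbstar ∧ ∀ r ∈ Set.Ici Re, Ts r ≤ Ts Rbstar) ∧
      ∀ Rbstar ∈ Set.Ici Re, (∀ r ∈ Set.Ici Re, Ts r ≤ Ts Rbstar) →
        1 - regP N_B ((2 ^ Rbstar - 1) / γB) ^ N_A =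
          (Real.log 2 * N_A * (Rbstar - Re) * 2 ^ Rbstar / (Real.Gamma N_B * γB)) *
            ((2 ^ Rbstar - 1) / γB) ^ (N_B - 1) * Real.exp (-((2 ^ Rbstar - 1) / γB)) *
            regP N_B ((2 ^ Rbstar - 1) / γB) ^ (N_A - 1) := by
  have hB1 : (1 : ℝ) ≤ N_B := by exact_mod_cast hB
  have hB0 : (0 : ℝ) < N_B := by linarith
  have hl : 0 < Real.log 2 := Real.log_pos (by norm_num)
  have hy : ∀ r : ℝ, 0 ≤ r → 0 ≤ ((2 : ℝ) ^ r - 1) / γB := fun r hr =>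
    div_nonneg (sub_nonneg.2 (Real.one_le_rpow (by norm_num) hr)) hγ.le
  have hderiv : ∀ r, HasDerivAt Ts
      (1 * (1 - regP N_B ((2 ^ r - 1) / γB) ^ N_A) + (r - Re) *
        -(N_A * regP N_B ((2 ^ r - 1) / γB) ^ (N_A - 1) *
          (((2 ^ r - 1) / γB) ^ ((N_B : ℝ) - 1) * Real.exp (-((2 ^ r - 1) / γB)) /
            Real.Gamma N_B * (2 ^ r * Real.log 2 / γB)))) r := by
    intro r
    have h2 : HasDerivAt (fun r : ℝ => ((2 : ℝ) ^ r - 1) / γB) (2 ^ r * Real.log 2 / γB) r :=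
      ((Real.hasStrictDerivAt_const_rpow (by norm_num) r).hasDerivAt.sub_const 1).div_const γB
    have h3 := ((hasDerivAt_regP hB1 _).comp r h2).pow N_A
    exact (((hasDerivAt_id r).sub_const Re).mul (h3.const_sub 1)).congr_of_eventuallyEq
      (Eventually.of_forall hTs)
  have hzero : Ts Re = 0 := by simp [hTs]
  have hpos : ∀ r, Re < r → 0 < Ts r := by
    intro r hr
    have hr0 := hy r (hRe.trans hr.le)
    rw [hTs]
    exact mul_pos (sub_pos.2 hr) (sub_pos.2
      (pow_lt_one₀ (regP_nonneg hB0 hr0) (regP_lt_one hB0 hr0) (by omega)))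
  refine ⟨hzero, hpos, ?_, ?_⟩
  · set K : ℝ := 2 * N_A * N_B * γB / Real.log 2 ^ 2 with hK
    have hdecay : ∀ r, Re < r → Ts r * r ≤ K := by
      intro r hr
      have hr0 : 0 < r := hRe.trans_lt hr
      have hexp : (Real.log 2 * r) ^ 2 / 2 ≤ (2 : ℝ) ^ r - 1 := by
        rw [Real.rpow_def_of_pos (by norm_num)]
        have h := Real.quadratic_le_exp_of_nonneg (mul_pos hl hr0).le
        linarith [mul_pos hl hr0]
      have hy0 := hy r hr0.le
      set y : ℝ := ((2 : ℝ) ^ r - 1) / γB with hydef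
      have hyle : (Real.log 2 * r) ^ 2 / 2 ≤ y * γB := by
        rwa [hydef, div_mul_cancel₀ _ hγ.ne']
      have hQ : 0 ≤ 1 - regP N_B y := (sub_pos.2 (regP_lt_one hB0 hy0)).le
      have hmarkov := mul_one_sub_regP_le hB0 hy0
      have h1 : Ts r ≤ r * (N_A * (1 - regP N_B y)) := by
        rw [hTs]
        have h0 := (pow_le_one₀ (regP_nonneg hB0 hy0) (regP_lt_one hB0 hy0).le : _ ^ N_A ≤ (1 : ℝ))
        exact mul_le_mul (by linarith) (one_sub_pow_le (regP_nonneg hB0 hy0) N_A)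
          (sub_nonneg.2 h0) hr0.le
      rw [hK, le_div_iff₀ (by positivity)]
      calc Ts r * r * Real.log 2 ^ 2
          ≤ r * (N_A * (1 - regP N_B y)) * r * Real.log 2 ^ 2 := by gcongr
        _ = 2 * N_A * (1 - regP N_B y) * ((Real.log 2 * r) ^ 2 / 2) := by ring
        _ ≤ 2 * N_A * (1 - regP N_B y) * (y * γB) := by gcongr
        _ = 2 * N_A * γB * (y * (1 - regP N_B y)) := by ring
        _ ≤ 2 * N_A * γB * N_B := by gcongr
        _ = 2 * N_A * N_B * γB := by ring
    have hc : 0 < Ts (Re + 1) := hpos _ (by linarith)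
    set M : ℝ := max (Re + 1) (K / Ts (Re + 1))
    have hM : Re + 1 ≤ M := le_max_left _ _
    obtain ⟨x, hx, hmax⟩ := isCompact_Icc.exists_isMaxOn (s := Set.Icc Re M)
      ⟨Re + 1, by linarith, hM⟩ fun r _ => (hderiv r).continuousAt.continuousWithinAt
    have hx1 : Ts (Re + 1) ≤ Ts x := hmax ⟨by linarith, hM⟩
    refine ⟨x, lt_of_le_of_ne hx.1 ?_, fun r hr => ?_⟩
    · rintro rfl
      linarith
    · rcases le_or_gt r M with hrM | hrM
      · exact hmax ⟨hr, hrM⟩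
      · have hrRe : Re < r := by linarith
        have hKr : K < r * Ts (Re + 1) :=
          (div_lt_iff₀ hc).1 ((le_max_right _ _).trans_lt hrM)
        have hr0 : 0 < r := hRe.trans_lt hrRe
        nlinarith [hdecay r hrRe]
  · intro x hx hmax
    have hxRe : Re < x := by
      refine lt_of_le_of_ne hx ?_
      rintro rfl
      have h := hmax (Re + 1) (by simp)
      have := hpos (Re + 1) (by linarith)
      linarith
    have hloc : IsLocalMax Ts x := by
      filter_upwards [Ici_mem_nhds hxRe] with r hr using hmax r hr
    have h := hloc.hasDerivAt_eq_zero (hderiv x)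
    rw [show (N_B : ℝ) - 1 = ((N_B - 1 : ℕ) : ℝ) by push_cast [hB]; ring, Real.rpow_natCast] at h
    have hG := (Real.Gamma_pos_of_pos hB0).ne'
    rw [one_mul] at h
    rw [eq_neg_of_add_eq_zero_left h]
    field_simp
end
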